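/- Consider a discrete-time controlled system (S, U, F, ℓ) which is exponentially controllable with overshoot C ≥ 1 and decay rate σ ∈ (0,1). Fix a horizon N ≥ 2, an initial state x_0 ∈ S, and a control sequence u* attaining the infimum for horizon N from x_0, i.e. J_N(x_0, u*) = V_N(x_0); let x*_n denote the associated optimal trajectory, set λ_n = ℓ(x*_n, u*_n) for n = 0, …, N−1, and set ν = V_N(x*_1). Then for every j = 0, …, N−2 one has ν ≤ Σ_{n=0}^{j-1} λ_{n+1} + C · ((1 − σ^{N-j})/(1 − σ)) · λ_{j+1}. -/

import Mathlib

open Finset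

/-- Trajectory of the discrete-time controlled system `x_{n+1} = F (x_n, u_n)`. -/
def traj {S U : Type*} (F : S → U → S) (x : S) (u : ℕ → U) : ℕ → S
  | 0 => x
  | n + 1 => F (traj F x u n) (u n)

/-- Finite-horizon cost `J_N(x,u) = Σ_{n=0}^{N-1} ℓ(x_n, u_n)`. -/
noncomputable def costJ {S U : Type*} (F : S → U → S) (ℓ : S → U → ℝ)
    (N : ℕ) (x : S) (u : ℕ → U) : ℝ :=
  ∑ n ∈ Finset.range N, ℓ (traj F x u n) (u n)

/-- Finite-horizon value function `V_N(x) = inf_u J_N(x,u)`. -/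
noncomputable def valueV {S U : Type*} (F : S → U → S) (ℓ : S → U → ℝ)
    (N : ℕ) (x : S) : ℝ :=
  ⨅ u : ℕ → U, costJ F ℓ N x u

/-- Pointwise optimal running cost `ℓ*(x) = inf_{u ∈ U} ℓ(x,u)`. -/
noncomputable def ellStar {S U : Type*} (ℓ : S → U → ℝ) (x : S) : ℝ :=
  ⨅ u : U, ℓ x u

theorem traj_add {S U : Type*} (F : S → U → S) (x : S) (u : ℕ → U) (j m : ℕ) :
    traj F x u (j + m) = traj F (traj F x u j) (fun n => u (j + n)) m := by
  induction m with
  | zero => rfl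
  | succ m ih => rw [← add_assoc, traj, traj, ih]

theorem traj_congr {S U : Type*} (F : S → U → S) (x : S) {u v : ℕ → U} {n : ℕ}
    (h : ∀ k < n, u k = v k) : traj F x u n = traj F x v n := by
  induction n with
  | zero => rfl
  | succ n ih => rw [traj, traj, ih fun k hk => h k (by omega), h n (by omega)]

theorem costJ_congr {S U : Type*} (F : S → U → S) (ℓ : S → U → ℝ) (x : S) {u v : ℕ → U} {N : ℕ}
    (h : ∀ k < N, u k = v k) : costJ F ℓ N x u = costJ F ℓ N x v := by
  refine Finset.sum_congr rfl fun n hn => ?_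
  have hn := Finset.mem_range.mp hn
  rw [traj_congr F x fun k hk => h k (hk.trans hn), h n hn]

theorem costJ_add {S U : Type*} (F : S → U → S) (ℓ : S → U → ℝ) (x : S) (u : ℕ → U) (j m : ℕ) :
    costJ F ℓ (j + m) x u =
      costJ F ℓ j x u + costJ F ℓ m (traj F x u j) (fun n => u (j + n)) := by
  simp only [costJ, Finset.sum_range_add, traj_add]

theorem valueV_le_costJ {S U : Type*} (F : S → U → S) {ℓ : S → U → ℝ} (hℓ : ∀ x u, 0 ≤ ℓ x u)
    (N : ℕ) (x : S) (u : ℕ → U) : valueV F ℓ N x ≤ costJ F ℓ N x u :=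
  ciInf_le ⟨0, Set.forall_mem_range.mpr fun _ => Finset.sum_nonneg fun _ _ => hℓ _ _⟩ u

/-- Switching from the control `u` to the control `w` after `j` steps bounds the value function. -/
theorem valueV_add_le {S U : Type*} (F : S → U → S) {ℓ : S → U → ℝ} (hℓ : ∀ x u, 0 ≤ ℓ x u)
    (j m : ℕ) (x : S) (u w : ℕ → U) :
    valueV F ℓ (j + m) x ≤ costJ F ℓ j x u + costJ F ℓ m (traj F x u j) w := by
  let v : ℕ → U := fun n => if n < j then u n else w (n - j)
  have hv : ∀ k < j, v k = u k := fun k hk => if_pos hk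
  have hw : (fun n => v (j + n)) = w := by
    funext n
    simp [v]
  calc valueV F ℓ (j + m) x ≤ costJ F ℓ (j + m) x v := valueV_le_costJ F hℓ _ x v
    _ = costJ F ℓ j x u + costJ F ℓ m (traj F x u j) w := by
      rw [costJ_add, costJ_congr F ℓ x hv, traj_congr F x hv, hw]

theorem ellStar_le {S U : Type*} {ℓ : S → U → ℝ} (hℓ : ∀ x u, 0 ≤ ℓ x u) (x : S) (u : U) :
    ellStar ℓ x ≤ ℓ x u :=
  ciInf_le ⟨0, Set.forall_mem_range.mpr (hℓ x)⟩ u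

theorem costJ_le_of_exponential_bound {S U : Type*} (F : S → U → S) (ℓ : S → U → ℝ) {C σ a : ℝ}
    (hσ : σ ≠ 1) {x : S} {u : ℕ → U} (h : ∀ n, ℓ (traj F x u n) (u n) ≤ C * σ ^ n * a) (m : ℕ) :
    costJ F ℓ m x u ≤ C * ((1 - σ ^ m) / (1 - σ)) * a := by
  calc costJ F ℓ m x u ≤ ∑ n ∈ Finset.range m, C * σ ^ n * a := Finset.sum_le_sum fun n _ => h n
    _ = C * ((1 - σ ^ m) / (1 - σ)) * a := by
      rw [← Finset.sum_mul, ← Finset.mul_sum, geom_sum_eq hσ, ← neg_div_neg_eq, neg_sub, neg_sub]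

/-- Estimate (4.1) for `ν = V_N(x*_1)` (after Grüne, Proposition 4.1): from `x*_1`
one follows the shifted optimal control for `j` steps and then switches to a
controllability control from `x*_{j+1}`. -/
theorem value_at_next_state_estimate
    {S U : Type*} [Nonempty U] (F : S → U → S) (ℓ : S → U → ℝ)
    (hℓ : ∀ x u, 0 ≤ ℓ x u)
    (C σ : ℝ) (hC : 1 ≤ C) (hσ0 : 0 < σ) (hσ1 : σ < 1)
    (hexp : ∀ x : S, ∃ u : ℕ → U,
      ∀ n : ℕ, ℓ (traj F x u n) (u n) ≤ C * σ ^ n * ellStar ℓ x)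
    (N : ℕ) (hN : 2 ≤ N) (x₀ : S) (ustar : ℕ → U)
    (hopt : costJ F ℓ N x₀ ustar = valueV F ℓ N x₀)
    (lam : ℕ → ℝ) (hlam : ∀ n, lam n = ℓ (traj F x₀ ustar n) (ustar n))
    (ν : ℝ) (hν : ν = valueV F ℓ N (traj F x₀ ustar 1)) :
    ∀ j < N - 1, ν ≤ (∑ n ∈ Finset.range j, lam (n + 1)) +
      C * ((1 - σ ^ (N - j)) / (1 - σ)) * lam (j + 1) := by
  intro j hj
  have shift (n : ℕ) : traj F x₀ ustar (n + 1) =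
      traj F (traj F x₀ ustar 1) (fun k => ustar (1 + k)) n := by
    rw [add_comm, traj_add]
  obtain ⟨w, hw⟩ := hexp (traj F x₀ ustar (j + 1))
  have hle : ellStar ℓ (traj F x₀ ustar (j + 1)) ≤ lam (j + 1) := by
    rw [hlam]
    exact ellStar_le hℓ _ _
  have hbound (n : ℕ) :
      ℓ (traj F (traj F x₀ ustar (j + 1)) w n) (w n) ≤ C * σ ^ n * lam (j + 1) :=
    (hw n).trans (mul_le_mul_of_nonneg_left hle (by positivity))
  have htail := costJ_le_of_exponential_bound F ℓ hσ1.ne hbound (N - j)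
  have hhead : costJ F ℓ j (traj F x₀ ustar 1) (fun k => ustar (1 + k)) =
      ∑ n ∈ Finset.range j, lam (n + 1) := by
    refine Finset.sum_congr rfl fun n _ => ?_
    rw [hlam, shift n, add_comm n 1]
  have hswitch := valueV_add_le F hℓ j (N - j) (traj F x₀ ustar 1) (fun k => ustar (1 + k)) w
  rw [hhead, ← shift j, Nat.add_sub_cancel' (by omega), ← hν] at hswitch
  linarith
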